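/- arXiv:1406.0655 — 5 statements merged into one kernel-verified Lean document; each statement's English description precedes it below -/
import Mathlib

section
/- Let n be a positive integer and let γₙ = [[n,0],[0,1]]. The map πₙ : 𝓛_ℚ → 𝓛ₙ sending ψ to the pair (L_ψ, L_{γₙψ}) is surjective: for every pair of lattices (L, L') in ℂ with L ⊆ L' and L'/L cyclic of order n, there exists ψ ∈ 𝓛_ℚ with L_ψ = L and L_{γₙψ} = L'. -/
open Matrix

/-- The left action of a rational 2×2 matrix `γ` on `ψ : ℚ² →+ ℂ`, given by
`(γψ)(v) = (det γ)⁻¹ · ψ(vγ)` where `v` is a row vector. -/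
noncomputable def actL (γ : Matrix (Fin 2) (Fin 2) ℚ) (ψ : (Fin 2 → ℚ) →+ ℂ) :
    (Fin 2 → ℚ) →+ ℂ :=
  AddMonoidHom.mk' (fun v => ((γ.det : ℚ) : ℂ)⁻¹ * ψ (v ᵥ* γ))
    (fun v w => by simp only [Matrix.add_vecMul, map_add, mul_add])

/-- The lattice `L_ψ = ℤ·ψ(1,0) + ℤ·ψ(0,1)`. -/
noncomputable def latticeOf (ψ : (Fin 2 → ℚ) →+ ℂ) : AddSubgroup ℂ :=
  AddSubgroup.closure {ψ ![1, 0], ψ ![0, 1]}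

/-- Membership in `𝓛_ℚ`: `ψ(1,0)` and `ψ(0,1)` are `ℝ`-linearly independent and
`ψ(1,0)/ψ(0,1)` lies in the upper half-plane. -/
def IsLQ (ψ : (Fin 2 → ℚ) →+ ℂ) : Prop :=
  LinearIndependent ℝ ![ψ ![1, 0], ψ ![0, 1]] ∧ 0 < (ψ ![1, 0] / ψ ![0, 1]).im

/-- A lattice in `ℂ`: a subgroup of the form `ℤω₁ + ℤω₂` with `ω₁, ω₂`
linearly independent over `ℝ`. -/
def IsLattice (L : AddSubgroup ℂ) : Prop :=
  ∃ ω₁ ω₂ : ℂ, LinearIndependent ℝ ![ω₁, ω₂] ∧ L = AddSubgroup.closure {ω₁, ω₂}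

theorem aux_li (x y : ℂ) : LinearIndependent ℝ ![x, y] ↔ x.im * y.re - x.re * y.im ≠ 0 := by
  rw [LinearIndependent.pair_iff]
  constructor
  · intro h hD
    have h1 := h y.im (-x.im) (by
      apply Complex.ext
      · simp; linarith
      · simp; ring)
    have h2 := h y.re (-x.re) (by
      apply Complex.ext
      · simp; ring
      · simp; linarith)
    have hx : x = 0 := Complex.ext (by simpa using h2.2) (by simpa using h1.2)
    have h3 := h 1 0 (by simp [hx])
    exact one_ne_zero h3.1
  · intro hD s t hst
    have hr := congrArg Complex.re hst
    have hi := congrArg Complex.im hst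
    simp at hr hi
    constructor
    · have : s * (x.im * y.re - x.re * y.im) = 0 := by linear_combination y.re * hi - y.im * hr
      exact (mul_eq_zero.mp this).resolve_right hD
    · have : t * (x.im * y.re - x.re * y.im) = 0 := by linear_combination x.im * hr - x.re * hi
      exact (mul_eq_zero.mp this).resolve_right hD

theorem aux_im (x y : ℂ) (h : 0 < x.im * y.re - x.re * y.im) : 0 < (x / y).im := by
  have hy : y ≠ 0 := by
    rintro rfl
    simp at h
  have := Complex.normSq_pos.mpr hy
  rw [Complex.div_im, ← sub_div]
  exact div_pos h this

theorem aux_cyc (n : ℕ) (L L' : AddSubgroup ℂ)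
    (hcyc : IsAddCyclic (L' ⧸ L.addSubgroupOf L'))
    (hcard : Nat.card (L' ⧸ L.addSubgroupOf L') = n) :
    ∃ c ∈ L', (∀ z ∈ L', ∃ k : ℤ, z - k * c ∈ L) ∧ ∀ k : ℤ, (k : ℂ) * c ∈ L ↔ (n : ℤ) ∣ k := by
  obtain ⟨g, hg⟩ := hcyc.exists_generator
  obtain ⟨c, rfl⟩ := QuotientAddGroup.mk_surjective g
  refine ⟨c, c.2, ?_, ?_⟩
  · intro z hz
    obtain ⟨k, hk⟩ := AddSubgroup.mem_zmultiples_iff.mp (hg (QuotientAddGroup.mk ⟨z, hz⟩))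
    refine ⟨k, ?_⟩
    rw [← QuotientAddGroup.mk_zsmul, QuotientAddGroup.eq, AddSubgroup.mem_addSubgroupOf] at hk
    simpa [sub_eq_neg_add] using hk
  · intro k
    have ho : addOrderOf (QuotientAddGroup.mk c : L' ⧸ L.addSubgroupOf L') = n := by
      rw [← hcard]; exact addOrderOf_eq_card_of_forall_mem_zmultiples hg
    rw [← ho, addOrderOf_dvd_iff_zsmul_eq_zero, ← QuotientAddGroup.mk_zsmul,
      QuotientAddGroup.eq_zero_iff, AddSubgroup.mem_addSubgroupOf]
    simp

theorem aux_mem (x y z : ℂ) :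
    z ∈ AddSubgroup.closure {x, y} ↔ ∃ p q : ℤ, (p : ℂ) * x + q * y = z := by
  rw [AddSubgroup.mem_closure_pair]
  simp

/-- adapted basis -/
theorem aux_basis (n : ℕ) (hn : 0 < n) (L L' : AddSubgroup ℂ)
    (hL' : IsLattice L') (hle : L ≤ L')
    (hcyc : IsAddCyclic (L' ⧸ L.addSubgroupOf L'))
    (hcard : Nat.card (L' ⧸ L.addSubgroupOf L') = n) :
    ∃ a b : ℂ, a.im * b.re - a.re * b.im ≠ 0 ∧ (∀ z, z ∈ L' ↔ ∃ p q : ℤ, (p : ℂ) * a + q * b = z) ∧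
      (∀ z, z ∈ L ↔ ∃ p q : ℤ, (p : ℂ) * a + q * (n * b) = z) := by
  obtain ⟨w₁, w₂, hli, rfl⟩ := hL'
  obtain ⟨c, hc, hgen, hord⟩ := aux_cyc n L _ hcyc hcard
  rw [aux_li] at hli
  have hZ : ∀ (k : ℤ) (z : ℂ), z ∈ L → (k : ℂ) * z ∈ L := fun k z hz => by
    simpa using L.zsmul_mem hz k
  have h1 : ∃ X : ℤ, X ≠ 0 ∧ w₁ - X * c ∈ L := by
    obtain ⟨X, hX⟩ := hgen w₁ (AddSubgroup.subset_closure (by simp))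
    by_cases h0 : X = 0
    · refine ⟨n, by exact_mod_cast hn.ne', ?_⟩
      subst h0
      have := L.sub_mem hX ((hord n).mpr dvd_rfl)
      simpa using this
    · exact ⟨X, h0, hX⟩
  obtain ⟨X, hX0, hX⟩ := h1
  obtain ⟨Y, hY⟩ := hgen w₂ (AddSubgroup.subset_closure (by simp))
  obtain ⟨s, t, hst⟩ := (aux_mem _ _ _).mp hc
  set g : ℤ := ((Int.gcd X Y : ℕ) : ℤ) with hgdef
  have hg0 : g ≠ 0 := by
    simp [hgdef, Int.gcd_eq_zero_iff, hX0]
  obtain ⟨x, hx⟩ : g ∣ X := Int.gcd_dvd_left ..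
  obtain ⟨y, hy⟩ : g ∣ Y := Int.gcd_dvd_right ..
  obtain ⟨u, v, huv⟩ : ∃ u v : ℤ, g = X * u + Y * v := ⟨_, _, Int.gcd_eq_gcd_ab X Y⟩
  have hdet : x * u + y * v = 1 := by
    apply mul_left_cancel₀ hg0
    linear_combination -huv - u * hx - v * hy
  have hdetC : (x : ℂ) * u + y * v = 1 := by exact_mod_cast hdet
  have hdetR : (x : ℝ) * u + y * v = 1 := by exact_mod_cast hdet
  have hcop : IsCoprime (n : ℤ) g := by
    have : (n : ℤ) ∣ s * X + t * Y - 1 := by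
      rw [← hord]
      have := L.neg_mem (L.add_mem (hZ s _ hX) (hZ t _ hY))
      convert this using 1
      push_cast
      linear_combination hst
    obtain ⟨k, hk⟩ := this
    exact ⟨-k, s * x + t * y, by linear_combination hk - s * hx - t * hy⟩
  have hxC : (X : ℂ) = g * x := by exact_mod_cast hx
  have hyC : (Y : ℂ) = g * y := by exact_mod_cast hy
  have ha : (y : ℂ) * w₁ - x * w₂ ∈ L := by
    have := L.sub_mem (hZ y _ hX) (hZ x _ hY)
    convert this using 1
    rw [hxC, hyC]; ring
  have hb : ((u : ℂ) * w₁ + v * w₂) - g * c ∈ L := by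
    have := L.add_mem (hZ u _ hX) (hZ v _ hY)
    convert this using 1
    rw [hxC, hyC]; linear_combination (g : ℂ) * c * hdetC
  have hL'iff : ∀ z, z ∈ AddSubgroup.closure {w₁, w₂} ↔ ∃ p q : ℤ,
      (p : ℂ) * ((y : ℂ) * w₁ - x * w₂) + q * ((u : ℂ) * w₁ + v * w₂) = z := by
    intro z
    rw [aux_mem]
    constructor
    · rintro ⟨p, q, rfl⟩
      refine ⟨p * v - q * u, p * x + q * y, ?_⟩
      push_cast
      linear_combination (p * w₁ + q * w₂) * hdetC
    · rintro ⟨p, q, rfl⟩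
      refine ⟨p * y + q * u, -p * x + q * v, ?_⟩
      push_cast
      ring
  refine ⟨y * w₁ - x * w₂, u * w₁ + v * w₂, ?_, hL'iff, ?_⟩
  · convert hli using 1
    simp
    linear_combination (w₁.im * w₂.re - w₁.re * w₂.im) * hdetR
  · have key : ∀ q : ℤ, (q : ℂ) * (u * w₁ + v * w₂) ∈ L ↔ (n : ℤ) ∣ q := by
      intro q
      have e : (q : ℂ) * (u * w₁ + v * w₂) =
        q * ((u * w₁ + v * w₂) - g * c) + ((q * g : ℤ) : ℂ) * c := by push_cast; ring
      rw [e, L.add_mem_cancel_left (hZ q _ hb), hord]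
      exact ⟨fun h => hcop.dvd_of_dvd_mul_right h, fun h => h.mul_right _⟩
    intro z
    constructor
    · intro hz
      obtain ⟨p, q, rfl⟩ := (hL'iff z).mp (hle hz)
      obtain ⟨k, rfl⟩ := (key q).mp ((L.add_mem_cancel_left (hZ p _ ha)).mp hz)
      exact ⟨p, k, by push_cast; ring⟩
    · rintro ⟨p, q, rfl⟩
      refine L.add_mem (hZ p _ ha) (hZ q _ ?_)
      simpa using (key n).mpr dvd_rfl

/-- the homomorphism with prescribed values -/
noncomputable def auxPsi (a b : ℂ) : (Fin 2 → ℚ) →+ ℂ :=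
  AddMonoidHom.mk' (fun v => (v 0 : ℂ) * a + (v 1 : ℂ) * b)
    (fun v w => by simp only [Pi.add_apply, Rat.cast_add]; ring)

/-- the map `πₙ : 𝓛_ℚ → 𝓛ₙ`, `ψ ↦ (L_ψ, L_{γₙψ})` with
`γₙ = [[n,0],[0,1]]`, is surjective: every pair of lattices `L ⊆ L'` in `ℂ` with
`L'/L` cyclic of order `n` is of the form `(L_ψ, L_{γₙψ})` for some `ψ ∈ 𝓛_ℚ`. -/
theorem stmt7 (n : ℕ) (hn : 0 < n) (L L' : AddSubgroup ℂ)
    (hL : IsLattice L) (hL' : IsLattice L') (hle : L ≤ L')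
    (hcyc : IsAddCyclic (L' ⧸ L.addSubgroupOf L'))
    (hcard : Nat.card (L' ⧸ L.addSubgroupOf L') = n) :
    ∃ ψ : (Fin 2 → ℚ) →+ ℂ, IsLQ ψ ∧ latticeOf ψ = L ∧
      latticeOf (actL !![(n : ℚ), 0; 0, 1] ψ) = L' := by
  obtain ⟨a, b, hab, h1, h2⟩ : ∃ a b : ℂ, 0 < a.im * b.re - a.re * b.im ∧
      (∀ z, z ∈ L' ↔ ∃ p q : ℤ, (p : ℂ) * a + q * b = z) ∧
      (∀ z, z ∈ L ↔ ∃ p q : ℤ, (p : ℂ) * a + q * (n * b) = z) := by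
    obtain ⟨a, b, hab, h1, h2⟩ := aux_basis n hn L L' hL' hle hcyc hcard
    rcases lt_or_gt_of_ne hab with h | h
    · refine ⟨-a, b, by simp; linarith, fun z => (h1 z).trans ?_, fun z => (h2 z).trans ?_⟩ <;>
      · constructor <;>
        · rintro ⟨p, q, rfl⟩
          exact ⟨-p, q, by push_cast; ring⟩
    · exact ⟨a, b, h, h1, h2⟩
  have hnR : (0 : ℝ) < n := by exact_mod_cast hn
  have hnC : (n : ℂ) ≠ 0 := by exact_mod_cast hn.ne'
  have e1 : auxPsi a (n * b) ![1, 0] = a := by simp [auxPsi]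
  have e2 : auxPsi a (n * b) ![0, 1] = n * b := by simp [auxPsi]
  have e3 : actL !![(n : ℚ), 0; 0, 1] (auxPsi a (n * b)) ![1, 0] = a := by
    simp [actL, auxPsi, Matrix.det_fin_two, Matrix.vecMul, dotProduct, Fin.sum_univ_two, hnC]
  have e4 : actL !![(n : ℚ), 0; 0, 1] (auxPsi a (n * b)) ![0, 1] = b := by
    simp [actL, auxPsi, Matrix.det_fin_two, Matrix.vecMul, dotProduct, Fin.sum_univ_two, hnC]
  have hpos : 0 < a.im * ((n : ℂ) * b).re - a.re * ((n : ℂ) * b).im := by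
    have := mul_pos hnR hab
    simp
    linarith
  refine ⟨auxPsi a (n * b), ⟨?_, ?_⟩, ?_, ?_⟩
  · rw [e1, e2, aux_li]
    exact hpos.ne'
  · rw [e1, e2]
    exact aux_im _ _ hpos
  · ext z
    rw [latticeOf, e1, e2, aux_mem, h2]
  · ext z
    rw [latticeOf, e3, e4, aux_mem, h1]
end

section
/- Let m be a positive integer, let ζ ∈ ℂ be a primitive m-th root of unity, and let x ∈ ℂ satisfy x^m ≠ 1. Then ∑_{k=1}^{m−1} ζ^k x/(1 − ζ^k x)² = m² x^m/(1 − x^m)² − x/(1 − x)². (All denominators are nonzero under the hypothesis x^m ≠ 1.) -/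
theorem aux_ne (m : ℕ) (ζ x : ℂ) (hζ : IsPrimitiveRoot ζ m)
    (hx : x ^ m ≠ 1) (k : ℕ) : 1 - ζ ^ k * x ≠ 0 := by
  intro h
  apply hx
  have h1 : ζ ^ k * x = 1 := (sub_eq_zero.mp h).symm
  have h2 : (ζ ^ k * x) ^ m = x ^ m := by
    rw [mul_pow, ← pow_mul, mul_comm k m, pow_mul, hζ.pow_eq_one, one_pow, one_mul]
  rw [← h2, h1, one_pow]

theorem aux_sum (m : ℕ) (hm : 0 < m) (ζ x : ℂ) (hζ : IsPrimitiveRoot ζ m)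
    (hx : x ^ m ≠ 1) :
    ∑ k ∈ Finset.range m, (1 - ζ ^ k * x)⁻¹ = (m : ℂ) * (1 - x ^ m)⁻¹ := by
  have hxm : 1 - x ^ m ≠ 0 := fun h => hx (sub_eq_zero.mp h).symm
  have h1 : ∀ k ∈ Finset.range m, (1 - ζ ^ k * x)⁻¹ =
      (∑ j ∈ Finset.range m, (ζ ^ j) ^ k * x ^ j) * (1 - x ^ m)⁻¹ := by
    intro k _
    have h2 : (ζ ^ k * x) ^ m = x ^ m := by
      rw [mul_pow, ← pow_mul, mul_comm k m, pow_mul, hζ.pow_eq_one, one_pow, one_mul]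
    have h3 := geom_sum_mul_neg (ζ ^ k * x) m
    rw [h2] at h3
    have h4 : ∑ j ∈ Finset.range m, (ζ ^ j) ^ k * x ^ j
        = ∑ j ∈ Finset.range m, (ζ ^ k * x) ^ j := by
      refine Finset.sum_congr rfl fun j _ => ?_
      rw [mul_pow, ← pow_mul, ← pow_mul, mul_comm k j]
    rw [h4, eq_mul_inv_iff_mul_eq₀ hxm, ← h3, mul_comm (∑ j ∈ Finset.range m, _),
      inv_mul_cancel_left₀ (aux_ne m ζ x hζ hx k)]
  rw [Finset.sum_congr rfl h1, ← Finset.sum_mul, Finset.sum_comm]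
  congr 1
  rw [Finset.sum_eq_single 0]
  · simp
  · intro j hj hj0
    rw [← Finset.sum_mul]
    have hne : ζ ^ j ≠ 1 := hζ.pow_ne_one_of_pos_of_lt hj0 (Finset.mem_range.mp hj)
    have h5 := geom_sum_mul (ζ ^ j) m
    rw [← pow_mul, mul_comm j m, pow_mul, hζ.pow_eq_one, one_pow, sub_self] at h5
    rw [(mul_eq_zero.mp h5).resolve_right (sub_ne_zero.mpr hne), zero_mul]
  · intro h
    exact absurd (Finset.mem_range.mpr hm) h

/-- for `ζ` a primitive `m`-th root of unity in `ℂ` and `x ∈ ℂ` with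
`x^m ≠ 1`, one has `∑_{k=1}^{m−1} ζ^k x/(1 − ζ^k x)² = m² x^m/(1 − x^m)² − x/(1 − x)²`. -/
theorem stmt9 (m : ℕ) (hm : 0 < m) (ζ x : ℂ) (hζ : IsPrimitiveRoot ζ m)
    (hx : x ^ m ≠ 1) :
    ∑ k ∈ Finset.Ico 1 m, ζ ^ k * x / (1 - ζ ^ k * x) ^ 2 =
      (m : ℂ) ^ 2 * x ^ m / (1 - x ^ m) ^ 2 - x / (1 - x) ^ 2 := by
  have hxm : 1 - x ^ m ≠ 0 := fun h => hx (sub_eq_zero.mp h).symm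
  have hL : HasDerivAt (fun y : ℂ => ∑ k ∈ Finset.range m, (1 - ζ ^ k * y)⁻¹)
      (∑ k ∈ Finset.range m, -(-(ζ ^ k * 1)) / (1 - ζ ^ k * x) ^ 2) x := by
    refine HasDerivAt.fun_sum fun k _ => ?_
    exact (((hasDerivAt_id x).const_mul (ζ ^ k)).const_sub 1).fun_inv
      (aux_ne m ζ x hζ hx k)
  have hR : HasDerivAt (fun y : ℂ => (m : ℂ) * (1 - y ^ m)⁻¹)
      ((m : ℂ) * (-(-((m : ℂ) * x ^ (m - 1))) / (1 - x ^ m) ^ 2)) x :=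
    (((hasDerivAt_pow m x).const_sub 1).fun_inv hxm).const_mul _
  have hev : (fun y : ℂ => ∑ k ∈ Finset.range m, (1 - ζ ^ k * y)⁻¹) =ᶠ[nhds x]
      (fun y : ℂ => (m : ℂ) * (1 - y ^ m)⁻¹) := by
    have : ∀ᶠ y in nhds x, y ^ m ≠ 1 :=
      (continuous_pow m).continuousAt.eventually_ne hx
    filter_upwards [this] with y hy
    exact aux_sum m hm ζ y hζ hy
  have hd := hL.unique (hR.congr_of_eventuallyEq hev)
  have hd2 : ∑ k ∈ Finset.range m, ζ ^ k * x / (1 - ζ ^ k * x) ^ 2 =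
      (m : ℂ) ^ 2 * x ^ m / (1 - x ^ m) ^ 2 := by
    have hp : x ^ m = x ^ (m - 1) * x := by
      rw [← pow_succ, Nat.sub_add_cancel hm]
    calc _ = (∑ k ∈ Finset.range m, -(-(ζ ^ k * 1)) / (1 - ζ ^ k * x) ^ 2) * x := by
          rw [Finset.sum_mul]
          refine Finset.sum_congr rfl fun k _ => ?_
          ring
      _ = (m : ℂ) ^ 2 * (x ^ (m - 1) * x) / (1 - x ^ m) ^ 2 := by
          rw [hd]
          ring
      _ = _ := by rw [← hp]
  rw [← hd2, Finset.range_eq_Ico, Finset.sum_eq_sum_Ico_succ_bot hm]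
  simp
end

section
/- Let m be a positive integer, let ζ ∈ ℂ be a primitive m-th root of unity, and let x ∈ ℂ with |x| < 1. Then ∑_{k=1}^{m−1} ζ^k x/(1 − ζ^k x)² = m² ∑_{l=1}^∞ l x^{lm} − ∑_{l=1}^∞ l x^l, where both infinite series converge absolutely. -/
/-- for `ζ` a primitive `m`-th root of unity in `ℂ` and `x ∈ ℂ` with
`|x| < 1`, one has `∑_{k=1}^{m−1} ζ^k x/(1 − ζ^k x)² = m² ∑_{l≥1} l x^{lm} − ∑_{l≥1} l x^l`,
where both infinite series converge absolutely. -/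
theorem stmt10 (m : ℕ) (hm : 0 < m) (ζ x : ℂ) (hζ : IsPrimitiveRoot ζ m)
    (hx : ‖x‖ < 1) :
    (Summable fun l : ℕ => ‖(l : ℂ) * x ^ (l * m)‖) ∧
    (Summable fun l : ℕ => ‖(l : ℂ) * x ^ l‖) ∧
    ∑ k ∈ Finset.Ico 1 m, ζ ^ k * x / (1 - ζ ^ k * x) ^ 2 =
      (m : ℂ) ^ 2 * ∑' l : ℕ, (l : ℂ) * x ^ (l * m) - ∑' l : ℕ, (l : ℂ) * x ^ l := by
  have hs : ∀ y : ℂ, ‖y‖ < 1 → Summable fun l : ℕ => ‖(l : ℂ) * y ^ l‖ := fun y hy => by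
    simpa using summable_norm_pow_mul_geometric_of_norm_lt_one 1 hy
  have hxm : ‖x ^ m‖ < 1 := by
    rw [norm_pow]
    exact pow_lt_one₀ (norm_nonneg _) hx hm.ne'
  have h1 : Summable fun l : ℕ => ‖(l : ℂ) * x ^ (l * m)‖ := by
    have h := hs _ hxm
    simp only [← pow_mul] at h
    simpa only [mul_comm m] using h
  refine ⟨h1, hs x hx, ?_⟩
  have hn : ‖ζ‖ = 1 := hζ.norm'_eq_one hm.ne'
  have hk : ∀ k ∈ Finset.range m, HasSum (fun l : ℕ => (l : ℂ) * (ζ ^ k * x) ^ l)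
      (ζ ^ k * x / (1 - ζ ^ k * x) ^ 2) := fun k _ =>
    hasSum_coe_mul_geometric_of_norm_lt_one (by simpa [hn] using hx)
  have hA := hasSum_sum hk
  have hc : ∀ l : ℕ, ∑ k ∈ Finset.range m, (l : ℂ) * (ζ ^ k * x) ^ l
      = if m ∣ l then (l : ℂ) * x ^ l * m else 0 := by
    intro l
    have e : ∑ k ∈ Finset.range m, (l : ℂ) * (ζ ^ k * x) ^ l
        = (l : ℂ) * x ^ l * ∑ k ∈ Finset.range m, (ζ ^ l) ^ k := by
      rw [Finset.mul_sum]
      refine Finset.sum_congr rfl fun k _ => ?_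
      rw [mul_pow, ← pow_mul, ← pow_mul, mul_comm k l]
      ring
    rw [e]
    split_ifs with hd
    · rw [(hζ.pow_eq_one_iff_dvd l).2 hd]
      simp
    · have hw : ζ ^ l ≠ 1 := fun h => hd ((hζ.pow_eq_one_iff_dvd l).1 h)
      rw [geom_sum_eq hw, ← pow_mul, mul_comm l m, pow_mul, hζ.pow_eq_one]
      simp
  simp only [hc] at hA
  have hinj : Function.Injective (fun l : ℕ => l * m) := fun a b h =>
    Nat.eq_of_mul_eq_mul_right hm h
  rw [← hinj.hasSum_iff] at hA
  · have hB : HasSum (fun l : ℕ => (m : ℂ) ^ 2 * ((l : ℂ) * x ^ (l * m)))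
        (∑ k ∈ Finset.range m, ζ ^ k * x / (1 - ζ ^ k * x) ^ 2) := by
      convert hA using 2 with l
      simp
      ring
    have hC := hB.tsum_eq
    rw [tsum_mul_left] at hC
    rw [hC, tsum_coe_mul_geometric_of_norm_lt_one hx, Finset.range_eq_Ico,
      Finset.sum_eq_sum_Ico_succ_bot hm]
    simp
  · intro l hl
    rw [if_neg]
    rintro ⟨c, rfl⟩
    exact hl ⟨c, mul_comm _ _⟩
end

section
/- Let m be a positive integer and let ζ ∈ ℂ be a primitive m-th root of unity. Then ∑_{k=1}^{m−1} ζ^k/(1 − ζ^k)² = (1 − m²)/12. -/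
lemma aux_S1 (z : ℂ) (n : ℕ) :
    (z - 1) * ∑ j ∈ Finset.range n, (j : ℂ) * z ^ j + z * ∑ j ∈ Finset.range n, z ^ j
      = n * z ^ n := by
  induction n with
  | zero => simp
  | succ n ih =>
    rw [Finset.sum_range_succ, Finset.sum_range_succ]
    push_cast
    linear_combination ih

lemma aux_S2 (z : ℂ) (n : ℕ) :
    (z - 1) * ∑ j ∈ Finset.range n, (j : ℂ) ^ 2 * z ^ j
      + 2 * z * ∑ j ∈ Finset.range n, (j : ℂ) * z ^ j + z * ∑ j ∈ Finset.range n, z ^ j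
      = n ^ 2 * z ^ n := by
  induction n with
  | zero => simp
  | succ n ih =>
    rw [Finset.sum_range_succ, Finset.sum_range_succ, Finset.sum_range_succ]
    push_cast
    linear_combination ih

lemma aux_geom (z : ℂ) (m : ℕ) (h : z ^ m = 1) (h1 : z ≠ 1) :
    ∑ j ∈ Finset.range m, z ^ j = 0 := by
  rw [geom_sum_eq h1, h]; simp

lemma aux_q (z : ℂ) (m : ℕ) (hm : 0 < m) (h : z ^ m = 1) (h1 : z ≠ 1) :
    z / (1 - z) ^ 2 = ∑ j ∈ Finset.range m, ((j : ℂ) * (m - j) / (2 * m)) * z ^ j := by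
  have e1 := aux_S1 z m
  have e2 := aux_S2 z m
  rw [aux_geom z m h h1, h] at e1 e2
  have hm' : (m : ℂ) ≠ 0 := by exact_mod_cast hm.ne'
  have hz : 1 - z ≠ 0 := sub_ne_zero.mpr h1.symm
  have e3 : ∑ j ∈ Finset.range m, ((j : ℂ) * (m - j) / (2 * m)) * z ^ j
      = (m * ∑ j ∈ Finset.range m, (j : ℂ) * z ^ j
        - ∑ j ∈ Finset.range m, (j : ℂ) ^ 2 * z ^ j) / (2 * m) := by
    rw [Finset.mul_sum, ← Finset.sum_sub_distrib, Finset.sum_div]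
    refine Finset.sum_congr rfl fun j _ => ?_
    ring
  rw [e3, div_eq_div_iff (pow_ne_zero 2 hz) (by simpa using hm')]
  linear_combination (-(m : ℂ) * (z - 1) - 2 * z) * e1 + (z - 1) * e2

lemma aux_sum_s11 (c : ℂ) (n : ℕ) :
    ∑ j ∈ Finset.range n, (j : ℂ) * (c - j) = c * (n * (n - 1) / 2)
      - n * (n - 1) * (2 * n - 1) / 6 := by
  induction n with
  | zero => simp
  | succ n ih =>
    rw [Finset.sum_range_succ, ih]
    push_cast
    ring

/-- for `ζ` a primitive `m`-th root of unity in `ℂ`, one has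
`∑_{k=1}^{m−1} ζ^k/(1 − ζ^k)² = (1 − m²)/12`. -/
theorem stmt11 (m : ℕ) (hm : 0 < m) (ζ : ℂ) (hζ : IsPrimitiveRoot ζ m) :
    ∑ k ∈ Finset.Ico 1 m, ζ ^ k / (1 - ζ ^ k) ^ 2 =
      (1 - (m : ℂ) ^ 2) / 12 := by
  have hm' : (m : ℂ) ≠ 0 := by exact_mod_cast hm.ne'
  have hp : ∀ k : ℕ, (ζ ^ k) ^ m = 1 := fun k => by
    rw [← pow_mul, mul_comm, pow_mul, hζ.pow_eq_one, one_pow]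
  have hne : ∀ k : ℕ, 0 < k → k < m → ζ ^ k ≠ 1 := fun k h0 h1 =>
    hζ.pow_ne_one_of_pos_of_lt h0.ne' h1
  have key : ∀ j ∈ Finset.range m, ∑ k ∈ Finset.Ico 1 m,
      ((j : ℂ) * (m - j) / (2 * m)) * (ζ ^ k) ^ j = (-1 / (2 * m)) * ((j : ℂ) * (m - j)) := by
    intro j hj
    rcases Nat.eq_zero_or_pos j with rfl | h0
    · simp
    · have hg := aux_geom (ζ ^ j) m (hp j) (hne j h0 (Finset.mem_range.mp hj))
      rw [Finset.range_eq_Ico, Finset.sum_eq_sum_Ico_succ_bot hm] at hg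
      have hs : ∑ k ∈ Finset.Ico 1 m, (ζ ^ k) ^ j = -1 := by
        have : ∑ k ∈ Finset.Ico 1 m, (ζ ^ k) ^ j = ∑ k ∈ Finset.Ico (0 + 1) m, (ζ ^ j) ^ k :=
          Finset.sum_congr rfl fun k _ => by rw [← pow_mul, ← pow_mul, mul_comm]
        rw [this]
        linear_combination hg
      rw [← Finset.mul_sum, hs]
      ring
  rw [Finset.sum_congr rfl fun k hk => aux_q (ζ ^ k) m hm (hp k)
    (hne k (Finset.mem_Ico.mp hk).1 (Finset.mem_Ico.mp hk).2), Finset.sum_comm,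
    Finset.sum_congr rfl key, ← Finset.mul_sum, aux_sum_s11]
  field_simp
  ring
end

section
/- Let q ∈ ℂ with 0 < |q| < 1, let s ∈ ℂ be a square root of q (s² = q), and let ζ ∈ ℂ be a primitive 20th root of unity. Then the double series ∑_{j=1}^{19} ∑_{n∈ℤ} (s^j ζ^j q^n)/(1 − s^j ζ^j q^n)² converges absolutely (all denominators being nonzero), and −38·Ê₂(q) + ∑_{j=1}^{19} ∑_{n∈ℤ} (s^j ζ^j q^n)/(1 − s^j ζ^j q^n)² = 40·(Ê₂⁽⁵⁾(q) − 3·Ê₂⁽¹⁰⁾(q) + Ê₂⁽²⁰⁾(q)), where Ê₂(q) = −1/24 + ∑_{m=1}^∞ σ₁(m) q^m and Ê₂⁽ᵈ⁾(q) = Ê₂(q) − d·Ê₂(q^d). Equivalently, the right-hand side equals −40·Ê₂(q) − 200·Ê₂(q⁵) + 1200·Ê₂(q¹⁰) − 800·Ê₂(q²⁰). (This is the q-expansion identity for the weight-2 form A_{β₄₀} attached to the matrix β₄₀ = [[−10,1],[−120,10]] inducing the hyperelliptic involution of X₀(40), evaluated on the Tate curve: the double sum runs over the 19 nonidentity elements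 s^jζ^j of the order-20 cyclic subgroup of ℂ^×/q^ℤ generated by sζ.) -/
/-- The normalized Eisenstein series of weight 2:
`Ê₂(q) = −1/24 + ∑_{m≥1} σ₁(m) q^m`, where `σ₁(m)` is the sum of the positive
divisors of `m`. -/
noncomputable def E2 (q : ℂ) : ℂ :=
  -1 / 24 + ∑' m : ℕ, (∑ d ∈ (m + 1).divisors, (d : ℂ)) * q ^ (m + 1)

/-- `Ê₂⁽ᵈ⁾(q) = Ê₂(q) − d·Ê₂(q^d)`. -/
noncomputable def E2d (d : ℕ) (q : ℂ) : ℂ := E2 q - d * E2 (q ^ d)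

/-- The function `x / (1 - x)^2`. -/
noncomputable def gfun (x : ℂ) : ℂ := x / (1 - x) ^ 2

lemma gfun_inv (x : ℂ) : gfun x⁻¹ = gfun x := by
  unfold gfun
  by_cases hx : x = 0
  · simp [hx]
  by_cases h1 : x = 1
  · simp [h1]
  have h2 : 1 - x ≠ 0 := fun h => h1 (by linear_combination -h)
  have h3 : x - 1 ≠ 0 := fun h => h1 (by linear_combination h)
  have : 1 - x⁻¹ = (x - 1) / x := by field_simp
  rw [this]
  field_simp
  ring

lemma root_sum {ω : ℂ} (hω : IsPrimitiveRoot ω 10) (m : ℕ) :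
    ∑ k ∈ Finset.range 10, (ω ^ k) ^ m = if 10 ∣ m then 10 else 0 := by
  have e : ∀ k, (ω ^ k) ^ m = (ω ^ m) ^ k := fun k => by rw [← pow_mul, ← pow_mul, mul_comm]
  simp only [e]
  split_ifs with h
  · rw [(hω.pow_eq_one_iff_dvd m).2 h]; simp
  · have h1 : ω ^ m ≠ 1 := fun h' => h ((hω.pow_eq_one_iff_dvd m).1 h')
    rw [geom_sum_eq h1, ← pow_mul, mul_comm, pow_mul, hω.pow_eq_one]
    simp

lemma dist10 {ω : ℂ} (hω : IsPrimitiveRoot ω 10) {x : ℂ} (hx : x ^ 10 ≠ 1) :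
    ∑ k ∈ Finset.range 10, gfun (ω ^ k * x) = 100 * gfun (x ^ 10) := by
  have hx' : 1 - x ^ 10 ≠ 0 := fun h => hx (by linear_combination -h)
  have key : ∀ k ∈ Finset.range 10, gfun (ω ^ k * x) =
      ∑ m ∈ Finset.range 20, (if m ≤ 10 then (m : ℂ) else 20 - m) * x ^ m / (1 - x ^ 10) ^ 2
        * (ω ^ k) ^ m := by
    intro k _
    have hk : (ω ^ k) ^ 10 = 1 := by rw [← pow_mul, mul_comm, pow_mul, hω.pow_eq_one, one_pow]
    generalize ω ^ k = w at hk
    have hw : (w * x) ^ 10 = x ^ 10 := by rw [mul_pow, hk, one_mul]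
    have e : ∀ m ∈ Finset.range 20, (if m ≤ 10 then (m : ℂ) else 20 - m) * x ^ m / (1 - x ^ 10) ^ 2
        * w ^ m = (if m ≤ 10 then (m : ℂ) else 20 - m) * (w * x) ^ m / (1 - x ^ 10) ^ 2 := by
      intro m _; rw [mul_pow]; ring
    rw [Finset.sum_congr rfl e, ← Finset.sum_div, ← hw]
    rw [← hw] at hx'
    generalize w * x = y at *
    have hy : 1 - y ≠ 0 := fun h => hx' (by
      have : y = 1 := by linear_combination -h
      simp [this])
    unfold gfun
    rw [div_eq_div_iff (pow_ne_zero _ hy) (pow_ne_zero _ hx')]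
    simp [Finset.sum_range_succ]
    ring
  rw [Finset.sum_congr rfl key, Finset.sum_comm]
  simp only [← Finset.mul_sum, root_sum hω]
  unfold gfun
  simp [Finset.sum_range_succ]
  ring

lemma const10 {ω : ℂ} (hω : IsPrimitiveRoot ω 10) :
    ∑ k ∈ Finset.Ico 1 10, gfun (ω ^ k) = -33 / 4 := by
  have key : ∀ k ∈ Finset.Ico 1 10, gfun (ω ^ k) =
      ∑ i ∈ Finset.range 10, ∑ j ∈ Finset.range 10,
        (i * j / 100 : ℂ) * (ω ^ k) ^ (i + j + 1) := by
    intro k hk'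
    have hk : (ω ^ k) ^ 10 = 1 := by rw [← pow_mul, mul_comm, pow_mul, hω.pow_eq_one, one_pow]
    have h1 : ω ^ k ≠ 1 := by
      simp only [Finset.mem_Ico] at hk'
      exact hω.pow_ne_one_of_pos_of_lt (by omega) hk'.2
    generalize ω ^ k = y at *
    have hy : 1 - y ≠ 0 := fun h => h1 (by linear_combination -h)
    have hg : ∑ i ∈ Finset.range 10, y ^ i = 0 := by
      rw [geom_sum_eq h1, hk]; simp
    have hi : ∑ i ∈ Finset.range 10, (i : ℂ) * y ^ i = -10 / (1 - y) := by
      rw [eq_div_iff hy]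
      simp [Finset.sum_range_succ] at hg ⊢
      linear_combination hg - 9 * hk
    have : gfun y = y / 100 * ((∑ i ∈ Finset.range 10, (i : ℂ) * y ^ i) *
        ∑ i ∈ Finset.range 10, (i : ℂ) * y ^ i) := by
      rw [hi]; unfold gfun; field_simp; ring
    rw [this, Finset.sum_mul_sum, Finset.mul_sum]
    refine Finset.sum_congr rfl fun i _ => ?_
    rw [Finset.mul_sum]
    refine Finset.sum_congr rfl fun j _ => ?_
    ring
  have r : ∀ m, ∑ k ∈ Finset.Ico 1 10, (ω ^ k) ^ m = (if 10 ∣ m then 10 else 0) - 1 := by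
    intro m
    rw [← root_sum hω, Finset.range_eq_Ico,
      Finset.sum_eq_sum_Ico_succ_bot (a := 0) (b := 10) (by norm_num)]
    simp
  rw [Finset.sum_congr rfl key, Finset.sum_comm]
  have : ∀ i ∈ Finset.range 10, ∑ k ∈ Finset.Ico 1 10, ∑ j ∈ Finset.range 10,
      (i * j / 100 : ℂ) * (ω ^ k) ^ (i + j + 1) = ∑ j ∈ Finset.range 10, (i * j / 100 : ℂ) *
        ((if 10 ∣ i + j + 1 then 10 else 0) - 1) := by
    intro i _
    rw [Finset.sum_comm]
    simp only [← Finset.mul_sum, r]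
  rw [Finset.sum_congr rfl this]
  simp [Finset.sum_range_succ]
  norm_num

lemma gfun_neg {x : ℂ} (h : x ^ 2 ≠ 1) : gfun (-x) = -gfun x + 4 * gfun (x ^ 2) := by
  have h1 : 1 - x ≠ 0 := fun h' => h (by linear_combination (-1 - x) * h')
  have h2 : 1 + x ≠ 0 := fun h' => h (by linear_combination (x - 1) * h')
  have h3 : 1 - x ^ 2 = (1 - x) * (1 + x) := by ring
  unfold gfun
  rw [h3, sub_neg_eq_add]
  field_simp
  ring

lemma summable_gfun_nat {q : ℂ} (hq : ‖q‖ < 1) (x : ℂ) :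
    Summable fun n : ℕ => gfun (x * q ^ n) := by
  unfold gfun
  simp only [div_eq_mul_one_div (_ * _ ^ _)]
  have hq0 := tendsto_pow_atTop_nhds_zero_of_norm_lt_one hq
  refine Summable.mul_tendsto_const (c := 1 / (1 - x * 0) ^ 2) ?_ ?_
  · simp only [norm_mul, norm_pow]
    exact (summable_geometric_of_lt_one (norm_nonneg _) hq).mul_left _
  · rw [Nat.cofinite_eq_atTop]
    exact tendsto_const_nhds.div (((hq0.const_mul x).const_sub 1).pow 2) (by simp)

lemma summable_gfun_int {q : ℂ} (hq : ‖q‖ < 1) (x : ℂ) :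
    Summable fun n : ℤ => gfun (x * q ^ n) := by
  apply Summable.of_nat_of_neg
  · simpa using summable_gfun_nat hq x
  · convert! summable_gfun_nat hq x⁻¹ using 2 with n
    rw [← gfun_inv]; simp [mul_comm]

/-- the Lambert series. -/
noncomputable def Sfun (q : ℂ) : ℂ := ∑' n : ℕ, gfun (q ^ (n + 1))

lemma E2_eq {q : ℂ} (hq : ‖q‖ < 1) : E2 q = -1 / 24 + Sfun q := by
  unfold E2 Sfun
  congr 1
  have h := tsum_prod_pow_eq_tsum_sigma 1 hq
  rw [tsum_pnat_eq_tsum_succ (f := fun d => ∑' c : ℕ+, (c : ℂ) ^ 1 * q ^ (d * c : ℕ)),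
    tsum_pnat_eq_tsum_succ (f := fun e => (ArithmeticFunction.sigma 1 e : ℂ) * q ^ e)] at h
  simp only [ArithmeticFunction.sigma_one_apply, Nat.cast_sum] at h
  rw [← h]
  refine tsum_congr fun n => ?_
  have hn : ‖q ^ (n + 1)‖ < 1 := by
    rw [norm_pow]; exact pow_lt_one₀ (norm_nonneg _) hq (by omega)
  unfold gfun
  rw [← tsum_coe_mul_geometric_of_norm_lt_one hn]
  have := tsum_pnat_eq_tsum_succ (f := fun c : ℕ => (c : ℂ) ^ 1 * q ^ ((n + 1) * c : ℕ))
  rw [this]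
  have hs := (hasSum_coe_mul_geometric_of_norm_lt_one hn).summable
  rw [hs.tsum_eq_zero_add]
  simp [pow_mul]

lemma norm_pow_lt {q : ℂ} (hq : ‖q‖ < 1) {k : ℕ} (hk : k ≠ 0) : ‖q ^ k‖ < 1 := by
  rw [norm_pow]; exact pow_lt_one₀ (norm_nonneg _) hq hk

lemma pow_ne_one_of_norm {q : ℂ} (hq : ‖q‖ < 1) {k : ℕ} (hk : k ≠ 0) : q ^ k ≠ 1 := by
  intro h
  have := norm_pow_lt hq hk
  simp [h] at this

lemma summable_S {q : ℂ} (hq : ‖q‖ < 1) : Summable fun n : ℕ => gfun (q ^ (n + 1)) := by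
  convert! summable_gfun_nat hq q using 3 with n
  ring

/-- the odd part. -/
lemma odd_tsum {Q : ℂ} (hQ : ‖Q‖ < 1) :
    ∑' n : ℤ, gfun (-Q ^ (2 * n + 1)) = 2 * (-Sfun Q + 5 * Sfun (Q ^ 2) - 4 * Sfun (Q ^ 4)) := by
  have hodd : ∀ {R : ℂ}, ‖R‖ < 1 → Summable fun n : ℕ => gfun (R ^ (2 * n + 1)) := by
    intro R hR
    convert! summable_gfun_nat (norm_pow_lt hR two_ne_zero) R using 3 with n
    ring
  have hS : ∀ {R : ℂ}, ‖R‖ < 1 → ∑' n : ℕ, gfun (R ^ (2 * n + 1)) = Sfun R - Sfun (R ^ 2) := by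
    intro R hR
    have e : (fun k : ℕ => gfun (R ^ (2 * k + 1 + 1))) = fun k => gfun ((R ^ 2) ^ (k + 1)) := by
      funext k; congr 1; ring
    have := tsum_even_add_odd (f := fun n : ℕ => gfun (R ^ (n + 1))) (hodd hR)
      (by rw [e]; exact summable_S (norm_pow_lt hR two_ne_zero))
    rw [e] at this
    unfold Sfun
    rw [← this]; ring
  have hnat : ∀ n : ℕ, gfun (-Q ^ (2 * n + 1)) =
      -gfun (Q ^ (2 * n + 1)) + 4 * gfun ((Q ^ 2) ^ (2 * n + 1)) := by
    intro n
    rw [gfun_neg (by rw [← pow_mul]; exact pow_ne_one_of_norm hQ (by omega)), ← pow_mul, ← pow_mul,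
      mul_comm (2 * n + 1) 2]
  have h2 := norm_pow_lt hQ two_ne_zero
  have hsum : HasSum (fun n : ℕ => gfun (-Q ^ (2 * n + 1)))
      (-Sfun Q + 5 * Sfun (Q ^ 2) - 4 * Sfun (Q ^ 4)) := by
    have a := (hodd hQ).hasSum
    have b := (hodd h2).hasSum
    rw [hS hQ] at a
    rw [hS h2] at b
    convert! a.neg.add (b.mul_left 4) using 1
    · funext n; exact hnat n
    · rw [← pow_mul]; ring
  have f := HasSum.of_nat_of_neg_add_one (f := fun n : ℤ => gfun (-Q ^ (2 * n + 1)))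
    (m := (-Sfun Q + 5 * Sfun (Q ^ 2) - 4 * Sfun (Q ^ 4)))
    (m' := (-Sfun Q + 5 * Sfun (Q ^ 2) - 4 * Sfun (Q ^ 4))) (by exact_mod_cast hsum) (by
      convert! hsum using 2 with n
      rw [← gfun_inv, inv_neg, ← zpow_neg]
      have e : -(2 * (-((n : ℤ) + 1)) + 1) = ((2 * n + 1 : ℕ) : ℤ) := by push_cast; ring
      rw [e, zpow_natCast])
  rw [f.tsum_eq]; ring

lemma even_tsum {q ω : ℂ} (hq : ‖q‖ < 1) (hω : IsPrimitiveRoot ω 10) :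
    ∑' n : ℤ, ∑ k ∈ Finset.Ico 1 10, gfun (ω ^ k * q ^ n) =
      -33 / 4 + 2 * (100 * Sfun (q ^ 10) - Sfun q) := by
  have h10 : ‖q ^ 10‖ < 1 := norm_pow_lt hq (by norm_num)
  have gen : ∀ x : ℂ, x ^ 10 ≠ 1 → ∑ k ∈ Finset.Ico 1 10, gfun (ω ^ k * x) =
      100 * gfun (x ^ 10) - gfun x := by
    intro x hx
    rw [← dist10 hω hx, Finset.range_eq_Ico,
      Finset.sum_eq_sum_Ico_succ_bot (a := 0) (b := 10) (by norm_num)]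
    simp
  have hsum : HasSum (fun n : ℕ => 100 * gfun ((q ^ (n + 1)) ^ 10) - gfun (q ^ (n + 1)))
      (100 * Sfun (q ^ 10) - Sfun q) := by
    have a := (summable_S hq).hasSum
    have b := (summable_S h10).hasSum
    convert! (b.mul_left 100).sub a using 1
    funext n
    rw [← pow_mul, ← pow_mul, mul_comm 10]
  have hne : ∀ n : ℕ, (q ^ (n + 1)) ^ 10 ≠ 1 := fun n => by
    rw [← pow_mul]; exact pow_ne_one_of_norm hq (by omega)
  have f := HasSum.of_add_one_of_neg_add_one
    (f := fun n : ℤ => ∑ k ∈ Finset.Ico 1 10, gfun (ω ^ k * q ^ n))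
    (m := 100 * Sfun (q ^ 10) - Sfun q) (m' := 100 * Sfun (q ^ 10) - Sfun q) (by
      convert! hsum using 2 with n
      have : q ^ ((n : ℤ) + 1) = q ^ (n + 1) := by exact_mod_cast rfl
      rw [this, gen _ (hne n)]) (by
      convert! hsum using 2 with n
      have : q ^ (-((n : ℤ) + 1)) = (q ^ (n + 1))⁻¹ := by rw [zpow_neg]; exact_mod_cast rfl
      rw [this, gen _ (by rw [inv_pow]; simpa using hne n), inv_pow, gfun_inv, gfun_inv])
  rw [f.tsum_eq]
  simp only [zpow_zero, mul_one, const10 hω]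
  ring

/-- the q-expansion identity for the weight-2 form `A_{β₄₀}` attached
to the matrix `β₄₀ = [[−10,1],[−120,10]]` inducing the hyperelliptic involution of
`X₀(40)`, evaluated on the Tate curve.  For `0 < |q| < 1`, `s² = q` and `ζ` a
primitive 20th root of unity, the double series
`∑_{j=1}^{19} ∑_{n∈ℤ} (s^j ζ^j q^n)/(1 − s^j ζ^j q^n)²` converges absolutely
(all denominators being nonzero), and
`−38·Ê₂(q) + ∑_{j=1}^{19} ∑_{n∈ℤ} (s^j ζ^j q^n)/(1 − s^j ζ^j q^n)²
  = 40·(Ê₂⁽⁵⁾(q) − 3·Ê₂⁽¹⁰⁾(q) + Ê₂⁽²⁰⁾(q))`,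
which moreover equals `−40·Ê₂(q) − 200·Ê₂(q⁵) + 1200·Ê₂(q¹⁰) − 800·Ê₂(q²⁰)`. -/
theorem stmt14 (q s ζ : ℂ) (hq0 : q ≠ 0) (hq : ‖q‖ < 1) (hs : s ^ 2 = q)
    (hζ : IsPrimitiveRoot ζ 20) :
    (∀ j ∈ Finset.Ico 1 20, ∀ n : ℤ, 1 - s ^ j * ζ ^ j * q ^ n ≠ 0) ∧
    (∀ j ∈ Finset.Ico 1 20, Summable fun n : ℤ =>
      ‖s ^ j * ζ ^ j * q ^ n / (1 - s ^ j * ζ ^ j * q ^ n) ^ 2‖) ∧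
    -38 * E2 q + ∑ j ∈ Finset.Ico 1 20, ∑' n : ℤ,
        s ^ j * ζ ^ j * q ^ n / (1 - s ^ j * ζ ^ j * q ^ n) ^ 2 =
      40 * (E2d 5 q - 3 * E2d 10 q + E2d 20 q) ∧
    40 * (E2d 5 q - 3 * E2d 10 q + E2d 20 q) =
      -40 * E2 q - 200 * E2 (q ^ 5) + 1200 * E2 (q ^ 10) - 800 * E2 (q ^ 20) := by
  have hs0 : s ≠ 0 := by rintro rfl; simp at hs; exact hq0 hs.symm
  have hsn : ‖s‖ < 1 := by
    have : ‖s‖ ^ 2 < 1 := by rw [← norm_pow, hs]; exact hq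
    exact (pow_lt_one_iff_of_nonneg (norm_nonneg _) two_ne_zero).1 this
  have hω : IsPrimitiveRoot (ζ ^ 2) 10 := hζ.pow (by norm_num) (by norm_num)
  refine ⟨?_, ?_, ?_, ?_⟩
  · intro j hj n h
    have h1 : s ^ j * ζ ^ j * q ^ n = 1 := by linear_combination -h
    have hz : s ^ j * q ^ n = s ^ ((j : ℤ) + 2 * n) := by
      rw [zpow_add₀ hs0, zpow_mul, zpow_natCast, ← hs]; norm_cast
    have h2 : ‖s‖ ^ ((j : ℤ) + 2 * n) = 1 := by
      have hζn : ‖ζ‖ = 1 := hζ.norm'_eq_one (by norm_num)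
      rw [← norm_zpow, ← hz]
      have := congrArg norm h1
      simpa [hζn] using this
    have h3 : (j : ℤ) + 2 * n = 0 := by
      exact (zpow_eq_one_iff_right₀ (norm_nonneg _) hsn.ne).1 h2
    rw [h3, zpow_zero] at hz
    have h4 : ζ ^ j = 1 := by linear_combination h1 - ζ ^ j * hz
    simp only [Finset.mem_Ico] at hj
    exact hζ.pow_ne_one_of_pos_of_lt (by omega) hj.2 h4
  · intro j _
    exact (summable_gfun_int hq (s ^ j * ζ ^ j)).norm
  · have hF : ∀ j, ∑' n : ℤ, s ^ j * ζ ^ j * q ^ n / (1 - s ^ j * ζ ^ j * q ^ n) ^ 2 =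
        ∑' n : ℤ, gfun (s ^ j * ζ ^ j * q ^ n) := fun j => rfl
    simp only [hF]
    have hshift : ∀ (x : ℂ) (k : ℕ), ∑' n : ℤ, gfun (x * q ^ k * q ^ n) =
        ∑' n : ℤ, gfun (x * q ^ n) := by
      intro x k
      rw [← (Equiv.addRight (k : ℤ)).tsum_eq (fun n : ℤ => gfun (x * q ^ n))]
      refine tsum_congr fun n => ?_
      simp only [Equiv.coe_addRight]
      rw [zpow_add₀ hq0, zpow_natCast]; congr 1; ring
    have he : ∀ k, ∑' n : ℤ, gfun (s ^ (2 * k) * ζ ^ (2 * k) * q ^ n) =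
        ∑' n : ℤ, gfun ((ζ ^ 2) ^ k * q ^ n) := by
      intro k
      rw [← hshift ((ζ ^ 2) ^ k) k]
      refine tsum_congr fun n => ?_
      rw [pow_mul, hs, pow_mul]; congr 1; ring
    have ho : ∀ k, ∑' n : ℤ, gfun (s ^ (2 * k + 1) * ζ ^ (2 * k + 1) * q ^ n) =
        ∑' n : ℤ, gfun ((ζ ^ 2) ^ k * (ζ * s) * q ^ n) := by
      intro k
      rw [← hshift ((ζ ^ 2) ^ k * (ζ * s)) k]
      refine tsum_congr fun n => ?_
      rw [pow_succ, pow_mul, hs, pow_succ, pow_mul]; congr 1; ring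
    have hsplit : ∀ F : ℕ → ℂ, ∑ j ∈ Finset.Ico 1 20, F j =
        ∑ k ∈ Finset.Ico 1 10, F (2 * k) + ∑ k ∈ Finset.range 10, F (2 * k + 1) := by
      intro F
      simp [Finset.sum_Ico_eq_sum_range, Finset.sum_range_succ]
      ring
    rw [hsplit]
    simp only [he, ho]
    rw [← Summable.tsum_finsetSum (fun k _ => summable_gfun_int hq _),
      ← Summable.tsum_finsetSum (fun k _ => summable_gfun_int hq _), even_tsum hq hω]
    have h10 : ζ ^ 10 = -1 := by
      have h : (ζ ^ 10) ^ 2 = 1 := by rw [← pow_mul]; exact hζ.pow_eq_one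
      rcases (sq_eq_sq_iff_eq_or_eq_neg (b := (1 : ℂ))).1 (by rw [h, one_pow]) with h | h
      · exact absurd h (hζ.pow_ne_one_of_pos_of_lt (by norm_num) (by norm_num))
      · exact h
    have hodd : ∀ n : ℤ, ∑ k ∈ Finset.range 10, gfun ((ζ ^ 2) ^ k * (ζ * s) * q ^ n) =
        100 * gfun (-(q ^ 5) ^ (2 * n + 1)) := by
      intro n
      have hx : (ζ * s * q ^ n) ^ 10 = -(q ^ 5) ^ (2 * n + 1) := by
        have e1 : (q ^ n) ^ 10 = (q ^ 5) ^ (2 * n) := by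
          rw [← zpow_natCast, ← zpow_natCast, ← zpow_mul, ← zpow_mul]; congr 1; push_cast; ring
        rw [zpow_add₀ (pow_ne_zero _ hq0), ← e1, mul_pow, mul_pow, h10, zpow_one, ← hs]; ring
      have hne : (ζ * s * q ^ n) ^ 10 ≠ 1 := by
        rw [hx]
        intro h
        have h2 := congrArg norm h
        rw [norm_neg, norm_zpow, norm_one] at h2
        have h5 := (zpow_eq_one_iff_right₀ (norm_nonneg _)
          (norm_pow_lt hq (k := 5) (by norm_num)).ne).1 h2
        omega
      simp only [mul_assoc] at hx hne ⊢
      rw [dist10 hω hne, hx]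
    simp only [hodd]
    rw [tsum_mul_left, odd_tsum (norm_pow_lt hq (by norm_num))]
    unfold E2d
    rw [E2_eq hq, E2_eq (norm_pow_lt hq (k := 5) (by norm_num)),
      E2_eq (norm_pow_lt hq (k := 10) (by norm_num)),
      E2_eq (norm_pow_lt hq (k := 20) (by norm_num)), ← pow_mul, ← pow_mul]
    push_cast
    norm_num
    ring
  · unfold E2d
    push_cast
    ring
end
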